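/- There exists a magic knight's tour of the 6×16 board: a knight's tour in which each of the six 16-cell rows sums to 776 and each of the sixteen 6-cell columns sums to 291. -/

import Mathlib

/-- Two cells are a knight's move apart: coordinate differences in absolute
value are {1,2}. -/
def knightMove {m n : ℕ} (a b : Fin m × Fin n) : Prop :=
  (((a.1.val : ℤ) - b.1.val).natAbs = 1 ∧ ((a.2.val : ℤ) - b.2.val).natAbs = 2) ∨
  (((a.1.val : ℤ) - b.1.val).natAbs = 2 ∧ ((a.2.val : ℤ) - b.2.val).natAbs = 1)

/-- A knight's tour of the m×n board: a bijective numbering (as an equiv from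
`Fin (m*n)`, representing the numbers 1,…,m·n) of the cells, such that
consecutive numbers occupy cells a knight's move apart. -/
def IsKnightTour (m n : ℕ) (t : Fin (m * n) ≃ Fin m × Fin n) : Prop :=
  ∀ (k : ℕ) (h : k + 1 < m * n),
    knightMove (t ⟨k, Nat.lt_of_succ_lt h⟩) (t ⟨k + 1, h⟩)

/-- The number (in 1,…,m·n) assigned to a cell by the tour. -/
def cellNum {m n : ℕ} (t : Fin (m * n) ≃ Fin m × Fin n) (c : Fin m × Fin n) : ℕ :=
  (t.symm c).val + 1

/-- The sum of the numbers in row `i` (an n-cell line). -/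
def rowSum {m n : ℕ} (t : Fin (m * n) ≃ Fin m × Fin n) (i : Fin m) : ℕ :=
  ∑ j : Fin n, cellNum t (i, j)

/-- The sum of the numbers in column `j` (an m-cell line). -/
def colSum {m n : ℕ} (t : Fin (m * n) ≃ Fin m × Fin n) (j : Fin n) : ℕ :=
  ∑ i : Fin m, cellNum t (i, j)

/-- The cells of a magic tour in the order visited, the cell `(i, j)` being encoded as `16 * i + j`. -/
def magicTourCells : Vector (Fin (6 * 16)) (6 * 16) :=
  ⟨#[51, 82, 64, 33, 0, 18, 4, 22, 53, 84, 70, 88, 55, 24, 10, 41,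
    74, 43, 12, 45, 76, 94, 63, 30, 44, 58, 25, 11, 29, 15, 46, 79,
    93, 75, 89, 71, 85, 52, 38, 56, 23, 5, 19, 1, 32, 65, 83, 50,
    81, 48, 66, 35, 17, 3, 21, 7, 40, 54, 36, 69, 87, 73, 91, 77,
    95, 62, 31, 13, 27, 9, 42, 60, 78, 47, 14, 28, 61, 92, 59, 90,
    57, 26, 8, 39, 72, 86, 68, 37, 6, 20, 2, 16, 34, 67, 49, 80], rfl⟩

/-- The zero-based numbers of the cells of the magic tour, one row of the board per line. -/
def magicTourNumbers : Vector (Fin (6 * 16)) (6 * 16) :=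
  ⟨#[4, 43, 90, 53, 6, 41, 88, 55, 82, 69, 14, 27, 18, 67, 74, 29,
    91, 52, 5, 42, 89, 54, 7, 40, 13, 26, 81, 68, 75, 28, 23, 66,
    44, 3, 92, 51, 58, 87, 38, 83, 56, 15, 70, 17, 24, 19, 30, 73,
    49, 94, 47, 0, 37, 8, 57, 12, 39, 80, 25, 78, 71, 76, 65, 22,
    2, 45, 50, 93, 86, 59, 10, 35, 84, 61, 16, 33, 20, 63, 72, 31,
    95, 48, 1, 46, 9, 36, 85, 60, 11, 34, 79, 62, 77, 32, 21, 64], rfl⟩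

/-- The magic tour of the 6×16 board as a numbering of the cells. -/
def magicTour : Fin (6 * 16) ≃ Fin 6 × Fin 16 :=
  Equiv.trans
    { toFun := fun k => magicTourCells[k]
      invFun := fun c => magicTourNumbers[c]
      left_inv := by unfold Function.LeftInverse; decide +kernel
      right_inv := by unfold Function.RightInverse Function.LeftInverse; decide +kernel }
    finProdFinEquiv.symm

instance {m n : ℕ} (a b : Fin m × Fin n) : Decidable (knightMove a b) :=
  inferInstanceAs (Decidable (_ ∨ _))

lemma isKnightTour_magicTour : IsKnightTour 6 16 magicTour := by
  have key : ∀ k : Fin 95, knightMove (magicTour k.castSucc) (magicTour k.succ) := by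
    decide +kernel
  exact fun k h => key ⟨k, by omega⟩

lemma rowSum_magicTour : ∀ i : Fin 6, rowSum magicTour i = 776 := by
  decide +kernel

lemma colSum_magicTour : ∀ j : Fin 16, colSum magicTour j = 291 := by
  decide +kernel

/-- There exists a magic knight's tour of the 6×16 board. -/
theorem magic_tour_6x16 :
    ∃ t : Fin (6 * 16) ≃ Fin 6 × Fin 16, IsKnightTour 6 16 t ∧
      (∀ i : Fin 6, rowSum t i = 776) ∧ (∀ j : Fin 16, colSum t j = 291) := by
  exact ⟨magicTour, isKnightTour_magicTour, rowSum_magicTour, colSum_magicTour⟩
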